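/- arXiv:2407.19230 — 2 statements merged into one kernel-verified Lean document; each statement's English description precedes it below -/
import Mathlib

section
/- Let k and n be positive integers and let p be a prime number with p ≡ 2 (mod 3). Then B_{3,7}( p^{2k} n + (p^{2k} − 1)/3 ) ≡ (−1)^k · ((−7/p)_L)^k · B_{3,7}(n) (mod 3). -/
/-- The number of `t`-regular partitions of `n`, i.e. partitions of `n`
none of whose parts is divisible by `t`. -/
noncomputable def regularPartitionCount (t n : ℕ) : ℕ :=
  Nat.card {π : n.Partition // ∀ x ∈ π.parts, ¬ t ∣ x}

/-- `B u v n` is the number of `(u,v)`-regular bipartitions of `n`: pairs `(α, β)` of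
partitions with `|α| + |β| = n`, `α` being `u`-regular and `β` being `v`-regular. -/
noncomputable def B (u v n : ℕ) : ℕ :=
  ∑ i ∈ Finset.range (n + 1), regularPartitionCount u i * regularPartitionCount v (n - i)

section GeneratingFunction

open PowerSeries PowerSeries.WithPiTopology

theorem regularPartitionCount_eq_card_countRestricted {t : ℕ} (ht : 0 < t) (n : ℕ) :
    regularPartitionCount t n = (Nat.Partition.countRestricted n t).card := by
  rw [← Nat.Partition.card_restricted_eq_card_countRestricted n ht, regularPartitionCount,
    Nat.card_eq_fintype_card, Fintype.card_subtype, Nat.Partition.restricted]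

theorem PowerSeries.WithPiTopology.continuous_expand (R : Type*) [CommRing R] [TopologicalSpace R]
    {t : ℕ} (ht : t ≠ 0) : Continuous (PowerSeries.expand (R := R) t ht) := by
  refine continuous_iff_continuousAt.2 fun f ↦ ?_
  rw [ContinuousAt, tendsto_iff_coeff_tendsto]
  intro d
  by_cases hd : t ∣ d
  · obtain ⟨m, rfl⟩ := hd
    simp only [coeff_expand_mul]
    exact (continuous_coeff R m).tendsto f
  · simp only [coeff_expand_of_not_dvd t ht _ hd]
    exact tendsto_const_nhds

theorem mk_regularPartitionCount_mul_pentagonalSeries (R : Type*) [CommRing R] [IsDomain R]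
    {t : ℕ} (ht : 0 < t) :
    PowerSeries.mk (fun n ↦ (regularPartitionCount t n : R)) * pentagonalSeries R =
      (pentagonalSeries R).expand t ht.ne' := by
  let _ : TopologicalSpace R := ⊥
  have _ : DiscreteTopology R := ⟨rfl⟩
  simp only [regularPartitionCount_eq_card_countRestricted ht]
  have h := (Nat.Partition.hasProd_powerSeriesMk_card_countRestricted R ht).mul
    (hasProd_one_sub_X_pow R)
  refine h.unique ?_
  convert! (hasProd_one_sub_X_pow R).map (PowerSeries.expand (R := R) t ht.ne')
    (continuous_expand R ht.ne') using 1
  ext1 i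
  simp only [Function.comp_apply, map_sub, map_one, map_pow, expand_X, pow_mul]
  rw [geom_sum_mul_neg, ← pow_mul, ← pow_mul, mul_comm]

theorem expand_pentagonalSeries_eq_pow (q : ℕ) [Fact q.Prime] :
    (pentagonalSeries (ZMod q)).expand q (NeZero.ne q) = pentagonalSeries (ZMod q) ^ q := by
  let _ : TopologicalSpace (ZMod q) := ⊥
  have _ : DiscreteTopology (ZMod q) := ⟨rfl⟩
  have h := (hasProd_one_sub_X_pow (ZMod q)).map (PowerSeries.expand (R := ZMod q) q (NeZero.ne q))
    (continuous_expand (ZMod q) (NeZero.ne q))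
  have h' := (hasProd_one_sub_X_pow (ZMod q)).map (powMonoidHom q) (continuous_pow q)
  refine h.unique ?_
  convert! h' using 1
  ext1 i
  have : CharP (ZMod q)⟦X⟧ q := charP_of_injective_algebraMap (C_injective (R := ZMod q)) q
  simp only [Function.comp_apply, map_sub, map_one, map_pow, expand_X, powMonoidHom_apply]
  rw [sub_pow_char, one_pow, ← pow_mul, ← pow_mul, mul_comm]

theorem pentagonalSeries_ne_zero (R : Type*) [CommRing R] [Nontrivial R] :
    pentagonalSeries R ≠ 0 := by
  intro h
  have := coeff_pentagonalSeries_pentagonal R 0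
  simp [h] at this

theorem cast_B_eq_coeff (R : Type*) [CommRing R] (u v n : ℕ) :
    (B u v n : R) = (PowerSeries.mk (fun n ↦ (regularPartitionCount u n : R)) *
      PowerSeries.mk (fun n ↦ (regularPartitionCount v n : R))).coeff n := by
  rw [coeff_mul, Finset.Nat.sum_antidiagonal_eq_sum_range_succ_mk]
  simp [B]

theorem cast_B_three_eq_coeff {v : ℕ} (hv : 0 < v) (n : ℕ) :
    (B 3 v n : ZMod 3) =
      (pentagonalSeries (ZMod 3) * (pentagonalSeries (ZMod 3)).expand v hv.ne').coeff n := by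
  rw [cast_B_eq_coeff]
  congr 1
  have h := mk_regularPartitionCount_mul_pentagonalSeries (ZMod 3) (t := 3) (by norm_num)
  rw [expand_pentagonalSeries_eq_pow 3, pow_succ] at h
  have h' := mul_right_cancel₀ (pentagonalSeries_ne_zero (ZMod 3)) h
  rw [h', ← mk_regularPartitionCount_mul_pentagonalSeries (ZMod 3) hv]
  ring

end GeneratingFunction

section QuadraticForm

/-- The pairs of odd integers `(x, y)` with `x ≡ y [ZMOD 4]` and `x ^ 2 + 7 * y ^ 2 = 8 * N`. -/
noncomputable def oddReps (N : ℕ) : Finset (ℤ × ℤ) :=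
  (Finset.Icc (-(8 * N : ℤ)) (8 * N) ×ˢ Finset.Icc (-(8 * N : ℤ)) (8 * N)).filter fun z ↦
    z.1 % 2 = 1 ∧ z.1 % 4 = z.2 % 4 ∧ z.1 ^ 2 + 7 * z.2 ^ 2 = 8 * N

/-- The sum of `x * y` modulo `3` over the pairs `(x, y)` in `oddReps N`. -/
noncomputable def repSum (N : ℕ) : ZMod 3 := ∑ z ∈ oddReps N, ((z.1 * z.2 : ℤ) : ZMod 3)

theorem mem_oddReps {N : ℕ} {z : ℤ × ℤ} :
    z ∈ oddReps N ↔ z.1 % 2 = 1 ∧ z.1 % 4 = z.2 % 4 ∧ z.1 ^ 2 + 7 * z.2 ^ 2 = 8 * N := by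
  simp only [oddReps, Finset.mem_filter, Finset.mem_product, Finset.mem_Icc, and_iff_right_iff_imp]
  rintro ⟨-, -, h⟩
  refine ⟨⟨?_, ?_⟩, ?_, ?_⟩ <;> nlinarith [Int.le_self_sq z.1, Int.le_self_sq z.2,
    Int.le_self_sq (-z.1), Int.le_self_sq (-z.2), sq_nonneg z.1, sq_nonneg z.2]

theorem sum_filter_dvd_oddReps {p : ℕ} (hp : p % 3 = 2) (hodd : p % 2 = 1) (N : ℕ) :
    ∑ z ∈ oddReps (p ^ 2 * N) with (p : ℤ) ∣ z.1 ∧ (p : ℤ) ∣ z.2,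
      ((z.1 * z.2 : ℤ) : ZMod 3) = repSum N := by
  have hp0 : (p : ℤ) ≠ 0 := by omega
  have hp4 : (p : ℤ) % 4 = 1 ∨ (p : ℤ) % 4 = 3 := by omega
  have hp3 : (((p : ℤ) ^ 2 : ℤ) : ZMod 3) = 1 := by
    have : (((p : ℤ) : ZMod 3)) = ((2 : ℤ) : ZMod 3) :=
      (ZMod.intCast_eq_intCast_iff _ _ 3).2 (by unfold Int.ModEq; omega)
    push_cast at this ⊢
    rw [this]; decide
  symm
  refine Finset.sum_nbij (fun z ↦ (p * z.1, p * z.2)) ?_ ?_ ?_ ?_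
  · rintro ⟨x, y⟩ hz
    simp only [mem_oddReps, Finset.mem_filter] at hz ⊢
    obtain ⟨h1, h2, h3⟩ := hz
    refine ⟨⟨?_, ?_, ?_⟩, dvd_mul_right _ _, dvd_mul_right _ _⟩
    · rw [Int.mul_emod, h1]; omega
    · rw [Int.mul_emod, h2, ← Int.mul_emod]
    · push_cast; linear_combination (p : ℤ) ^ 2 * h3
  · rintro ⟨x, y⟩ - ⟨x', y'⟩ - h
    simpa [hp0, Prod.ext_iff, show p ≠ 0 by omega] using h
  · rintro ⟨x, y⟩ hz
    simp only [mem_oddReps, Finset.coe_filter, Set.mem_ofPred_eq] at hz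
    obtain ⟨⟨h1, h2, h3⟩, ⟨u, rfl⟩, ⟨v, rfl⟩⟩ := hz
    refine ⟨(u, v), mem_oddReps.2 ⟨?_, ?_, ?_⟩, rfl⟩ <;> simp only
    · rw [Int.mul_emod] at h1
      rcases Int.emod_two_eq_zero_or_one u with hu | hu
      · simp [hu] at h1
      · exact hu
    · rcases hp4 with h4 | h4 <;> rw [Int.mul_emod, h4, Int.mul_emod p, h4] at h2 <;> omega
    · have : (p : ℤ) ^ 2 * (u ^ 2 + 7 * v ^ 2) = p ^ 2 * (8 * N) := by
        push_cast at h3; linear_combination h3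
      exact mul_left_cancel₀ (pow_ne_zero 2 hp0) this
  · rintro ⟨x, y⟩ -
    push_cast at hp3 ⊢
    linear_combination -(x * y : ZMod 3) * hp3

theorem repSum_sq_mul_of_legendreSym_eq_neg_one {p : ℕ} [Fact p.Prime] (hp : p % 3 = 2)
    (hodd : p % 2 = 1) (h : legendreSym p (-7) = -1) (N : ℕ) :
    repSum (p ^ 2 * N) = repSum N := by
  rw [← sum_filter_dvd_oddReps hp hodd N, Finset.filter_true_of_mem, repSum]
  rintro ⟨x, y⟩ hz
  obtain ⟨-, -, h3⟩ := mem_oddReps.1 hz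
  exact legendreSym.prime_dvd_of_eq_neg_one h
    ⟨p * (8 * N), by push_cast at h3; linear_combination h3⟩

theorem odd_add_of_eq_sq_add_seven_mul_sq {p : ℕ} (hodd : p % 2 = 1) {a b : ℤ}
    (hab : (p : ℤ) = a ^ 2 + 7 * b ^ 2) : Odd (a + b) := by
  have : Odd (a ^ 2 + 7 * b ^ 2) := by rw [← hab, Int.odd_iff]; omega
  revert this
  simp only [Int.odd_add, Int.odd_pow, Int.even_mul, Int.even_pow]
  simp [show ¬ Even (7 : ℤ) by decide]

theorem oddReps_mul_mem {p N : ℕ} (hodd : p % 2 = 1) {a b u v : ℤ}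
    (hab : (p : ℤ) = a ^ 2 + 7 * b ^ 2) (h : (u, v) ∈ oddReps (p * N)) :
    (a * u - 7 * b * v, b * u + a * v) ∈ oddReps (p ^ 2 * N) := by
  simp only [mem_oddReps] at h ⊢
  obtain ⟨h1, h2, h3⟩ := h
  obtain ⟨t, rfl⟩ : ∃ t, u = v + 4 * t := ⟨(u - v) / 4, by omega⟩
  have hab' := odd_add_of_eq_sq_add_seven_mul_sq hodd hab
  have hv : Odd v := Int.odd_iff.2 (by omega)
  refine ⟨?_, ?_, ?_⟩
  · rw [← Int.odd_iff, show a * (v + 4 * t) - 7 * b * v = (a + b) * v + 2 * (2 * a * t - 4 * b * v)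
      by ring]
    exact (hab'.mul hv).add_even (even_two_mul _)
  · rw [show a * (v + 4 * t) - 7 * b * v =
      b * (v + 4 * t) + a * v + 4 * (a * t - b * t - 2 * b * v) by ring]
    omega
  · push_cast at h3 ⊢
    rw [hab] at h3 ⊢
    linear_combination (a ^ 2 + 7 * b ^ 2) * h3

theorem exists_mem_oddReps_of_dvd {p N : ℕ} (hp : p.Prime) (hodd : p % 2 = 1) {a b x y : ℤ}
    (hab : (p : ℤ) = a ^ 2 + 7 * b ^ 2) (h : (x, y) ∈ oddReps (p ^ 2 * N))
    (hdvd : (p : ℤ) ∣ a * y - b * x) :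
    ∃ u v, (u, v) ∈ oddReps (p * N) ∧ a * u - 7 * b * v = x ∧ b * u + a * v = y := by
  have hp0 : (p : ℤ) ≠ 0 := mod_cast hp.ne_zero
  simp only [mem_oddReps] at h ⊢
  obtain ⟨h1, h2, h3⟩ := h
  obtain ⟨v, hv⟩ := hdvd
  obtain ⟨u, hu⟩ : (p : ℤ) ∣ a * x + 7 * b * y := by
    refine (Nat.prime_iff_prime_int.1 hp).dvd_of_dvd_pow (n := 2) ?_
    refine ⟨8 * p ^ 2 * N - 7 * p * v ^ 2, ?_⟩
    push_cast at h3
    linear_combination (-7) * (a * y - b * x + p * v) * hv + p * h3 -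
      (x ^ 2 + 7 * y ^ 2) * hab
  have hx : a * u - 7 * b * v = x := by
    refine mul_left_cancel₀ hp0 ?_
    linear_combination -a * hu + 7 * b * hv - x * hab
  have hy : b * u + a * v = y := by
    refine mul_left_cancel₀ hp0 ?_
    linear_combination -b * hu - a * hv - y * hab
  have hab' := odd_add_of_eq_sq_add_seven_mul_sq hodd hab
  have huv : (4 : ℤ) ∣ u - v := by
    have hcop : IsCoprime (4 : ℤ) (a - b) := by
      have : Odd (a - b) := by
        rw [show a - b = a + b + 2 * (-b) by ring]
        exact hab'.add_even (even_two_mul _)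
      rw [show (4 : ℤ) = 2 ^ 2 by norm_num]
      obtain ⟨c, hc⟩ := this
      exact IsCoprime.pow_left ⟨-c, 1, by linear_combination hc⟩
    refine hcop.dvd_of_dvd_mul_left ?_
    rw [show (a - b) * (u - v) = x - y + 4 * (2 * b * v) by rw [← hx, ← hy]; ring]
    omega
  refine ⟨u, v, ⟨?_, by omega, ?_⟩, hx, hy⟩
  · obtain ⟨t, ht⟩ := huv
    have : Odd ((a + b) * u) := by
      rw [show (a + b) * u = x + 2 * (4 * b * u - 14 * b * t) by
        rw [← hx]; linear_combination -7 * b * ht]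
      exact (Int.odd_iff.2 h1).add_even (even_two_mul _)
    exact Int.odd_iff.1 (Int.odd_mul.1 this).2
  · refine mul_left_cancel₀ hp0 ?_
    push_cast at h3 ⊢
    rw [← hx, ← hy] at h3
    linear_combination h3 + (u ^ 2 + 7 * v ^ 2) * hab

theorem sum_filter_dvd_sub_oddReps {p : ℕ} (hp : p.Prime) (hodd : p % 2 = 1) {a b : ℤ}
    (hab : (p : ℤ) = a ^ 2 + 7 * b ^ 2) (N : ℕ) :
    ∑ z ∈ oddReps (p ^ 2 * N) with (p : ℤ) ∣ a * z.2 - b * z.1, ((z.1 * z.2 : ℤ) : ZMod 3) =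
      ∑ z ∈ oddReps (p * N),
        (((a * z.1 - 7 * b * z.2) * (b * z.1 + a * z.2) : ℤ) : ZMod 3) := by
  have hp0 : (p : ℤ) ≠ 0 := mod_cast hp.ne_zero
  symm
  refine Finset.sum_nbij (fun z ↦ (a * z.1 - 7 * b * z.2, b * z.1 + a * z.2)) ?_ ?_ ?_ ?_
  · rintro ⟨u, v⟩ hz
    refine Finset.mem_filter.2 ⟨oddReps_mul_mem hodd hab hz, v, ?_⟩
    simp only
    linear_combination -v * hab
  · rintro ⟨u, v⟩ - ⟨u', v'⟩ - h
    simp only [Prod.mk.injEq] at h ⊢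
    obtain ⟨h1, h2⟩ := h
    constructor
    · refine mul_left_cancel₀ hp0 ?_
      linear_combination a * h1 + 7 * b * h2 + (u - u') * hab
    · refine mul_left_cancel₀ hp0 ?_
      linear_combination a * h2 - b * h1 + (v - v') * hab
  · rintro ⟨x, y⟩ hz
    obtain ⟨hz, hdvd⟩ := Finset.mem_filter.1 hz
    obtain ⟨u, v, h, hx, hy⟩ := exists_mem_oddReps_of_dvd hp hodd hab hz hdvd
    exact ⟨(u, v), h, by simp only [hx, hy]⟩
  · rintro ⟨u, v⟩ -
    rfl

theorem repSum_sq_mul_of_eq_sq_add_seven_mul_sq {p : ℕ} (hp : p.Prime) (hp3 : p % 3 = 2)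
    (hodd : p % 2 = 1) {a b : ℤ} (hab : (p : ℤ) = a ^ 2 + 7 * b ^ 2) (N : ℕ) :
    repSum (p ^ 2 * N) = -repSum N := by
  have hpZ : Prime (p : ℤ) := Nat.prime_iff_prime_int.1 hp
  have hab' : (p : ℤ) = a ^ 2 + 7 * (-b) ^ 2 := by rw [neg_sq]; exact hab
  have hab3 : (a ^ 2 : ZMod 3) = 1 ∧ (b ^ 2 : ZMod 3) = 1 := by
    have : (((p : ℤ) : ZMod 3)) = ((2 : ℤ) : ZMod 3) :=
      (ZMod.intCast_eq_intCast_iff _ _ 3).2 (by unfold Int.ModEq; omega)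
    rw [hab] at this
    push_cast at this
    revert this
    generalize (a : ZMod 3) = a'
    generalize (b : ZMod 3) = b'
    revert a' b'
    decide
  have hp1 : (1 : ℤ) < p := mod_cast hp.one_lt
  have hndvd : ∀ c : ℤ, (c ^ 2 : ZMod 3) = 1 → c ^ 2 ≤ p → ¬ (p : ℤ) ∣ c := by
    intro c hc hle hdvd
    have habs : |c| < p := abs_lt_of_sq_lt_sq (by nlinarith) (by omega)
    rw [Int.eq_zero_of_abs_lt_dvd hdvd habs] at hc
    revert hc
    decide
  have hpa := hndvd a hab3.1 (by nlinarith [sq_nonneg b])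
  have hpb := hndvd b hab3.2 (by nlinarith [sq_nonneg a, sq_nonneg b])
  have hp2 : ¬ (p : ℤ) ∣ 2 := by
    intro h
    have := Int.le_of_dvd two_pos h
    omega
  have hcover : oddReps (p ^ 2 * N) =
      {z ∈ oddReps (p ^ 2 * N) | (p : ℤ) ∣ a * z.2 - b * z.1} ∪
        {z ∈ oddReps (p ^ 2 * N) | (p : ℤ) ∣ a * z.2 - -b * z.1} := by
    rw [← Finset.filter_or, Finset.filter_true_of_mem]
    rintro ⟨x, y⟩ hz
    obtain ⟨-, -, h3⟩ := mem_oddReps.1 hz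
    refine hpZ.dvd_or_dvd ⟨y ^ 2 - b ^ 2 * (8 * p * N), ?_⟩
    push_cast at h3
    linear_combination -y ^ 2 * hab - b ^ 2 * h3
  have hinter : {z ∈ oddReps (p ^ 2 * N) | (p : ℤ) ∣ a * z.2 - b * z.1} ∩
      {z ∈ oddReps (p ^ 2 * N) | (p : ℤ) ∣ a * z.2 - -b * z.1} =
        {z ∈ oddReps (p ^ 2 * N) | (p : ℤ) ∣ z.1 ∧ (p : ℤ) ∣ z.2} := by
    rw [← Finset.filter_and]
    refine Finset.filter_congr fun z _ ↦ ⟨fun ⟨h1, h2⟩ ↦ ⟨?_, ?_⟩, fun ⟨h1, h2⟩ ↦ ⟨?_, ?_⟩⟩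
    · have := dvd_sub h2 h1
      rw [show a * z.2 - -b * z.1 - (a * z.2 - b * z.1) = 2 * (b * z.1) by ring] at this
      exact ((hpZ.dvd_or_dvd this).resolve_left hp2 |> hpZ.dvd_or_dvd).resolve_left hpb
    · have := dvd_add h1 h2
      rw [show a * z.2 - b * z.1 + (a * z.2 - -b * z.1) = 2 * (a * z.2) by ring] at this
      exact ((hpZ.dvd_or_dvd this).resolve_left hp2 |> hpZ.dvd_or_dvd).resolve_left hpa
    · exact dvd_sub (h2.mul_left a) (h1.mul_left b)
    · exact dvd_sub (h2.mul_left a) (h1.mul_left (-b))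
  have hsum := Finset.sum_union_inter (f := fun z : ℤ × ℤ ↦ ((z.1 * z.2 : ℤ) : ZMod 3))
    (s₁ := {z ∈ oddReps (p ^ 2 * N) | (p : ℤ) ∣ a * z.2 - b * z.1})
    (s₂ := {z ∈ oddReps (p ^ 2 * N) | (p : ℤ) ∣ a * z.2 - -b * z.1})
  rw [← hcover, hinter, sum_filter_dvd_oddReps hp3 hodd, sum_filter_dvd_sub_oddReps hp hodd hab,
    sum_filter_dvd_sub_oddReps hp hodd hab', ← Finset.sum_add_distrib] at hsum
  refine eq_neg_of_add_eq_zero_left (hsum.trans (Finset.sum_eq_zero fun z _ ↦ ?_))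
  have h30 : (3 : ZMod 3) = 0 := rfl
  push_cast
  linear_combination (2 * z.1 * z.2 : ZMod 3) * (hab3.1 - 7 * hab3.2) - 4 * z.1 * z.2 * h30

theorem exists_eq_five_mul_add_of_mem_oddReps_four_mul {N : ℕ} {x y : ℤ}
    (hz : (x, y) ∈ oddReps (4 * N)) : ∃ s, x = 5 * y + 16 * s := by
  simp only [mem_oddReps] at hz
  obtain ⟨h1, h2, h3⟩ := hz
  obtain ⟨t, rfl⟩ : ∃ t, x = y + 4 * t := ⟨(x - y) / 4, by omega⟩
  have h4 : (y ^ 2 + y * t + 2 * t ^ 2) % 4 = 0 := by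
    push_cast at h3
    have : y ^ 2 + y * t + 2 * t ^ 2 = 4 * N := by linarith
    omega
  have h5 : t % 4 = y % 4 := by
    have hy : y % 4 = 1 ∨ y % 4 = 3 := by omega
    have ht : t % 4 = 0 ∨ t % 4 = 1 ∨ t % 4 = 2 ∨ t % 4 = 3 := by omega
    rcases hy with hy | hy <;> rcases ht with ht | ht | ht | ht <;>
      simp [pow_two, Int.add_emod, Int.mul_emod, hy, ht] at h4 ⊢
  exact ⟨(t - y) / 4, by omega⟩

theorem repSum_four_mul (N : ℕ) : repSum (4 * N) = -repSum N := by
  rw [repSum, repSum, ← Finset.sum_neg_distrib]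
  symm
  refine Finset.sum_nbij' (fun z ↦ ((-3 * z.1 - 7 * z.2) / 2, (z.1 - 3 * z.2) / 2))
    (fun z ↦ ((-3 * z.1 + 7 * z.2) / 8, (-z.1 - 3 * z.2) / 8)) ?_ ?_ ?_ ?_ ?_
  · rintro ⟨x, y⟩ hz
    simp only [mem_oddReps] at hz ⊢
    obtain ⟨h1, h2, h3⟩ := hz
    obtain ⟨t, rfl⟩ : ∃ t, x = y + 4 * t := ⟨(x - y) / 4, by omega⟩
    rw [show (-3 * (y + 4 * t) - 7 * y) / 2 = -5 * y - 6 * t by omega,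
      show (y + 4 * t - 3 * y) / 2 = -y + 2 * t by omega]
    refine ⟨by omega, by omega, ?_⟩
    push_cast
    linear_combination 4 * h3
  · rintro ⟨x, y⟩ hz
    obtain ⟨s, rfl⟩ := exists_eq_five_mul_add_of_mem_oddReps_four_mul hz
    simp only [mem_oddReps] at hz ⊢
    obtain ⟨h1, h2, h3⟩ := hz
    rw [show (-3 * (5 * y + 16 * s) + 7 * y) / 8 = -y - 6 * s by omega,
      show (-(5 * y + 16 * s) - 3 * y) / 8 = -y - 2 * s by omega]
    refine ⟨by omega, by omega, ?_⟩
    push_cast at h3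
    linarith
  · rintro ⟨x, y⟩ hz
    simp only [mem_oddReps] at hz
    obtain ⟨h1, h2, h3⟩ := hz
    ext <;> simp only <;> omega
  · rintro ⟨x, y⟩ hz
    obtain ⟨s, rfl⟩ := exists_eq_five_mul_add_of_mem_oddReps_four_mul hz
    ext <;> simp only <;> omega
  · rintro ⟨x, y⟩ hz
    simp only [mem_oddReps] at hz
    obtain ⟨h1, h2, h3⟩ := hz
    obtain ⟨t, rfl⟩ : ∃ t, x = y + 4 * t := ⟨(x - y) / 4, by omega⟩
    simp only
    rw [show (-3 * (y + 4 * t) - 7 * y) / 2 = -5 * y - 6 * t by omega,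
      show (y + 4 * t - 3 * y) / 2 = -y + 2 * t by omega]
    have h30 : (3 : ZMod 3) = 0 := rfl
    push_cast
    linear_combination (-2 * y ^ 2 + 4 * t ^ 2 : ZMod 3) * h30

/-- An odd prime `p ≡ 2 [MOD 3]` modulo which `-7` is a square is of the form `a ^ 2 + 7 * b ^ 2`. -/
theorem exists_sq_add_seven_mul_sq {p : ℕ} [Fact p.Prime] (hp : p % 3 = 2)
    (hodd : p % 2 = 1) (h : IsSquare ((-7 : ℤ) : ZMod p)) :
    ∃ a b : ℤ, (p : ℤ) = a ^ 2 + 7 * b ^ 2 := by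
  have hpp : p.Prime := Fact.out
  have hpZ : Prime (p : ℤ) := Nat.prime_iff_prime_int.1 hpp
  obtain ⟨r, hr⟩ : ∃ r : ℤ, (p : ℤ) ∣ r ^ 2 + 7 := by
    obtain ⟨s, hs⟩ := h
    obtain ⟨r, rfl⟩ := ZMod.intCast_surjective s
    refine ⟨r, (ZMod.intCast_zmod_eq_zero_iff_dvd _ p).1 ?_⟩
    push_cast at hs ⊢
    linear_combination -hs
  have hsq : 0 < p.sqrt := Nat.sqrt_pos.2 hpp.pos
  obtain ⟨j, b, hb0, hb, hab⟩ := Real.exists_int_int_abs_mul_sub_le (r / p : ℝ) hsq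
  have hpR : (0 : ℝ) < p := mod_cast hpp.pos
  have hlt : (p : ℤ) < (p.sqrt + 1) ^ 2 := mod_cast Nat.lt_succ_sqrt' p
  have hle : (p.sqrt : ℤ) ^ 2 ≤ p := mod_cast Nat.sqrt_le' p
  have hb2 : b ^ 2 ≤ p := by nlinarith
  have hb2' : b ^ 2 ≠ p := fun hbp ↦ hpZ.irreducible.not_isSquare (hbp ▸ IsSquare.sq b)
  set a : ℤ := b * r - j * p with ha
  have ha2 : a ^ 2 < p := by
    have h1 : |(a : ℝ)| * (p.sqrt + 1) ≤ p := by
      have : (b * (r / p) - j : ℝ) = a / p := by rw [ha]; push_cast; field_simp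
      rw [this, abs_div, abs_of_pos hpR, div_le_div_iff₀ hpR (by positivity)] at hab
      linarith
    have h2 : |a| * (p.sqrt + 1) ≤ p := by exact_mod_cast h1
    have h3 : 0 ≤ |a| := abs_nonneg a
    have h4 : |a| < p.sqrt + 1 := by nlinarith
    have hpos : (0 : ℤ) < p := mod_cast hpp.pos
    rw [← sq_abs a]
    by_contra! hcon
    nlinarith
  obtain ⟨k, hk⟩ : (p : ℤ) ∣ a ^ 2 + 7 * b ^ 2 := by
    obtain ⟨c, hc⟩ := hr
    exact ⟨b ^ 2 * c - 2 * b * r * j + j ^ 2 * p, by rw [ha]; linear_combination b ^ 2 * hc⟩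
  have hpos : (0 : ℤ) < p := mod_cast hpp.pos
  have hk0 : 0 < k := by
    by_contra! hcon
    nlinarith [sq_nonneg a, mul_pos hb0 hb0]
  have hk8 : k < 8 := by
    by_contra! hcon
    have : b ^ 2 < p := lt_of_le_of_ne hb2 hb2'
    nlinarith
  have hpar : k % 2 = 0 → ∃ s t, a = 2 * s ∧ b = 2 * t := by
    intro hk2
    have heven : (a ^ 2 + 7 * b ^ 2) % 2 = 0 := by rw [hk, Int.mul_emod, hk2]; simp
    rcases Int.even_or_odd' a with ⟨s, hs | hs⟩ <;> rcases Int.even_or_odd' b with ⟨t, ht | ht⟩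
    · exact ⟨s, t, hs, ht⟩
    · rw [hs, ht] at heven
      ring_nf at heven
      omega
    · rw [hs, ht] at heven
      ring_nf at heven
      omega
    · obtain ⟨u, hu⟩ := Int.even_mul_succ_self s
      obtain ⟨v, hv⟩ := Int.even_mul_succ_self t
      have h8 : (p : ℤ) * k = 8 * (u + 7 * v + 1) := by
        rw [← hk, hs, ht]; linear_combination 4 * hu + 28 * hv
      interval_cases k <;> omega
  have hdvd : ∀ q : ℤ, q = 3 ∨ q = 5 → q ∣ k → ∃ s t, a = q * s ∧ b = q * t := by
    intro q hq hqk
    have hmod : (a ^ 2 + 7 * b ^ 2) % q = 0 :=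
      Int.emod_eq_zero_of_dvd (hk ▸ hqk.mul_left _)
    suffices q ∣ a ∧ q ∣ b by
      obtain ⟨⟨s, hs⟩, ⟨t, ht⟩⟩ := this
      exact ⟨s, t, hs, ht⟩
    rw [Int.dvd_iff_emod_eq_zero, Int.dvd_iff_emod_eq_zero]
    clear_value a
    rcases hq with rfl | rfl
    · have h1 : a % 3 = 0 ∨ a % 3 = 1 ∨ a % 3 = 2 := by omega
      have h2 : b % 3 = 0 ∨ b % 3 = 1 ∨ b % 3 = 2 := by omega
      rcases h1 with h1 | h1 | h1 <;> rcases h2 with h2 | h2 | h2 <;>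
        simp [pow_two, Int.add_emod, Int.mul_emod, h1, h2] at hmod ⊢
    · have h1 : a % 5 = 0 ∨ a % 5 = 1 ∨ a % 5 = 2 ∨ a % 5 = 3 ∨ a % 5 = 4 := by omega
      have h2 : b % 5 = 0 ∨ b % 5 = 1 ∨ b % 5 = 2 ∨ b % 5 = 3 ∨ b % 5 = 4 := by omega
      rcases h1 with h1 | h1 | h1 | h1 | h1 <;> rcases h2 with h2 | h2 | h2 | h2 | h2 <;>
        simp [pow_two, Int.add_emod, Int.mul_emod, h1, h2] at hmod ⊢
  have hthree : k % 3 ≠ 0 := by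
    intro hk3
    obtain ⟨s, t, hs, ht⟩ := hdvd 3 (Or.inl rfl) (Int.dvd_of_emod_eq_zero hk3)
    have h9 : (p : ℤ) * k = 9 * (s ^ 2 + 7 * t ^ 2) := by rw [← hk, hs, ht]; ring
    interval_cases k <;> omega
  interval_cases k
  · exact ⟨a, b, by linarith⟩
  · obtain ⟨s, t, hs, ht⟩ := hpar rfl
    rw [hs, ht] at hk
    ring_nf at hk
    omega
  · simp at hthree
  · obtain ⟨s, t, hs, ht⟩ := hpar rfl
    rw [hs, ht] at hk
    exact ⟨s, t, by linarith⟩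
  · obtain ⟨s, t, hs, ht⟩ := hdvd 5 (Or.inr rfl) (dvd_refl 5)
    have h5 : (p : ℤ) = 5 * (s ^ 2 + 7 * t ^ 2) := by rw [hs, ht] at hk; linarith
    have hp5 : p = 5 :=
      ((Nat.prime_dvd_prime_iff_eq Nat.prime_five hpp).1 (by omega)).symm
    have ht0 : 0 < t := by omega
    have : s ^ 2 + 7 * t ^ 2 = 1 := by rw [hp5] at h5; push_cast at h5; linarith
    nlinarith [sq_nonneg s]
  · simp at hthree
  · have : (7 : ℤ) ∣ a := Int.prime_ofNat_iff.2 (by norm_num : Nat.Prime 7) |>.dvd_of_dvd_pow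
      (⟨p - b ^ 2, by linarith⟩ : (7 : ℤ) ∣ a ^ 2)
    obtain ⟨s, hs⟩ := this
    rw [hs] at hk
    exact ⟨b, s, by linarith⟩

theorem repSum_sq_mul {p : ℕ} [Fact p.Prime] (hp : p % 3 = 2) (N : ℕ) :
    repSum (p ^ 2 * N) = -(legendreSym p (-7) : ZMod 3) * repSum N := by
  have hpp : p.Prime := Fact.out
  rcases hpp.eq_two_or_odd with rfl | hodd
  · have : legendreSym 2 (-7) = 1 := by
      rw [legendreSym.mod]
      exact legendreSym.at_one 2
    rw [this, show 2 ^ 2 * N = 4 * N by ring, repSum_four_mul]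
    simp
  · have h7 : ((-7 : ℤ) : ZMod p) ≠ 0 := by
      rw [Ne, ZMod.intCast_zmod_eq_zero_iff_dvd, dvd_neg]
      intro h
      have : p = 7 := (Nat.prime_dvd_prime_iff_eq hpp (by norm_num)).1 (mod_cast h)
      omega
    rcases legendreSym.eq_one_or_neg_one p h7 with h | h
    · obtain ⟨a, b, hab⟩ :=
        exists_sq_add_seven_mul_sq hp hodd ((legendreSym.eq_one_iff p h7).1 h)
      rw [repSum_sq_mul_of_eq_sq_add_seven_mul_sq hpp hp hodd hab, h]
      simp
    · rw [repSum_sq_mul_of_legendreSym_eq_neg_one hp hodd h, h]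
      simp

theorem repSum_pow_mul {p : ℕ} [Fact p.Prime] (hp : p % 3 = 2) (k N : ℕ) :
    repSum (p ^ (2 * k) * N) = (-(legendreSym p (-7) : ZMod 3)) ^ k * repSum N := by
  induction k with
  | zero => simp
  | succ k ih =>
    rw [show p ^ (2 * (k + 1)) * N = p ^ 2 * (p ^ (2 * k) * N) by ring, repSum_sq_mul hp, ih]
    ring

end QuadraticForm

section Comparison

open PowerSeries

theorem exists_pentagonal_of_int {x : ℤ} (h4 : x % 4 = 1) (h3 : x % 3 ≠ 0) :
    ∃ k : ℤ, 24 * (pentagonal k : ℤ) + 1 = x ^ 2 ∧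
      ((Int.negOnePow k : ℤ) : ZMod 3) = (x : ZMod 3) := by
  have h30 : (3 : ZMod 3) = 0 := rfl
  rcases (by omega : x % 12 = 1 ∨ x % 12 = 5) with h | h
  · obtain ⟨m, rfl⟩ : ∃ m, x = 1 - 6 * (2 * m) := ⟨(1 - x) / 12, by omega⟩
    refine ⟨2 * m, ?_, ?_⟩
    · linear_combination 12 * two_mul_natCast_pentagonal (2 * m)
    · rw [Int.negOnePow_even _ (even_two_mul m)]
      push_cast
      linear_combination (4 * m : ZMod 3) * h30
  · obtain ⟨m, rfl⟩ : ∃ m, x = 6 * (2 * m + 1) - 1 := ⟨(x - 5) / 12, by omega⟩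
    refine ⟨2 * m + 1, ?_, ?_⟩
    · linear_combination 12 * two_mul_natCast_pentagonal (2 * m + 1)
    · rw [Int.negOnePow_odd _ (odd_two_mul_add_one m)]
      push_cast
      linear_combination (-4 * m - 2 : ZMod 3) * h30

theorem exists_int_of_pentagonal (k : ℤ) :
    ∃ x : ℤ, x % 4 = 1 ∧ 24 * (pentagonal k : ℤ) + 1 = x ^ 2 := by
  rcases Int.even_or_odd' k with ⟨m, hm | hm⟩
  · refine ⟨1 - 6 * k, by omega, ?_⟩
    linear_combination 12 * two_mul_natCast_pentagonal k
  · refine ⟨6 * k - 1, by omega, ?_⟩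
    linear_combination 12 * two_mul_natCast_pentagonal k

theorem coeff_pentagonalSeries_of_sq {x : ℤ} {m : ℕ} (h4 : x % 4 = 1) (h3 : x % 3 ≠ 0)
    (hm : 24 * (m : ℤ) + 1 = x ^ 2) : (pentagonalSeries (ZMod 3)).coeff m = (x : ZMod 3) := by
  obtain ⟨k, hk, hx⟩ := exists_pentagonal_of_int h4 h3
  obtain rfl : m = pentagonal k := by omega
  rw [coeff_pentagonalSeries_pentagonal, ← hx]

theorem emod_three_ne_zero_of_mem_oddReps {n : ℕ} {x y : ℤ} (h : (x, y) ∈ oddReps (3 * n + 1)) :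
    x % 3 ≠ 0 ∧ y % 3 ≠ 0 := by
  obtain ⟨-, -, h⟩ := mem_oddReps.1 h
  simp only at h
  have hmod : (x ^ 2 + 7 * y ^ 2) % 3 = 2 := by push_cast at h; omega
  have h1 : x % 3 = 0 ∨ x % 3 = 1 ∨ x % 3 = 2 := by omega
  have h2 : y % 3 = 0 ∨ y % 3 = 1 ∨ y % 3 = 2 := by omega
  rcases h1 with h1 | h1 | h1 <;> rcases h2 with h2 | h2 | h2 <;>
    simp [pow_two, Int.add_emod, Int.mul_emod, h1, h2] at hmod ⊢

theorem repSum_eq_two_mul (N : ℕ) :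
    repSum N = 2 * ∑ z ∈ oddReps N with z.1 % 4 = 1, ((z.1 * z.2 : ℤ) : ZMod 3) := by
  rw [repSum, ← Finset.sum_filter_add_sum_filter_not (oddReps N) (fun z ↦ z.1 % 4 = 1), two_mul]
  congr 1
  refine Finset.sum_nbij' (fun z ↦ (-z.1, -z.2)) (fun z ↦ (-z.1, -z.2)) ?_ ?_ ?_ ?_ ?_
  · rintro ⟨x, y⟩ hz
    simp only [Finset.mem_filter, mem_oddReps, neg_sq] at hz ⊢
    exact ⟨⟨by omega, by omega, hz.1.2.2⟩, by omega⟩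
  · rintro ⟨x, y⟩ hz
    simp only [Finset.mem_filter, mem_oddReps, neg_sq] at hz ⊢
    exact ⟨⟨by omega, by omega, hz.1.2.2⟩, by omega⟩
  · simp
  · simp
  · simp

theorem sq_eq_of_emod_four {x : ℤ} (h4 : x % 4 = 1) (h3 : x % 3 ≠ 0) :
    24 * (((x ^ 2 / 24).toNat : ℕ) : ℤ) + 1 = x ^ 2 := by
  obtain ⟨k, hk, -⟩ := exists_pentagonal_of_int h4 h3
  omega

theorem coeff_pentagonalSeries_mul_expand_seven (n : ℕ) :
    (pentagonalSeries (ZMod 3) *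
      (pentagonalSeries (ZMod 3)).expand 7 (by norm_num)).coeff n =
      ∑ z ∈ oddReps (3 * n + 1) with z.1 % 4 = 1, ((z.1 * z.2 : ℤ) : ZMod 3) := by
  rw [coeff_mul]
  symm
  refine Finset.sum_of_injOn (fun z ↦ ((z.1 ^ 2 / 24).toNat, 7 * (z.2 ^ 2 / 24).toNat)) ?_ ?_ ?_ ?_
  · rintro ⟨x, y⟩ hz ⟨x', y'⟩ hz' h
    simp only [Finset.coe_filter, Set.mem_ofPred_eq] at hz hz'
    obtain ⟨hx3, hy3⟩ := emod_three_ne_zero_of_mem_oddReps hz.1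
    obtain ⟨hx3', hy3'⟩ := emod_three_ne_zero_of_mem_oddReps hz'.1
    obtain ⟨⟨-, hxy, -⟩, hx4⟩ := hz.imp_left mem_oddReps.1
    obtain ⟨⟨-, hxy', -⟩, hx4'⟩ := hz'.imp_left mem_oddReps.1
    simp only [Prod.mk.injEq] at h hxy hxy' ⊢
    have hx := sq_eq_of_emod_four hx4 hx3
    have hx' := sq_eq_of_emod_four hx4' hx3'
    have hy := sq_eq_of_emod_four (hxy.symm.trans hx4) hy3
    have hy' := sq_eq_of_emod_four (hxy'.symm.trans hx4') hy3'
    have h1 : x ^ 2 = x' ^ 2 := by omega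
    have h2 : y ^ 2 = y' ^ 2 := by omega
    rw [sq_eq_sq_iff_eq_or_eq_neg] at h1 h2
    constructor <;> omega
  · rintro ⟨x, y⟩ hz
    simp only [Finset.coe_filter, Set.mem_ofPred_eq] at hz
    obtain ⟨hx3, hy3⟩ := emod_three_ne_zero_of_mem_oddReps hz.1
    obtain ⟨⟨-, hxy, h⟩, hx4⟩ := hz.imp_left mem_oddReps.1
    simp only at h hxy hx4
    have hx := sq_eq_of_emod_four hx4 hx3
    have hy := sq_eq_of_emod_four (hxy.symm.trans hx4) hy3
    rw [Finset.mem_coe, Finset.HasAntidiagonal.mem_antidiagonal]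
    simp only
    push_cast at h
    omega
  · rintro ⟨i, j⟩ hij hne
    rw [Finset.HasAntidiagonal.mem_antidiagonal] at hij
    by_contra hcoeff
    obtain ⟨hi, hj⟩ := ne_zero_and_ne_zero_of_mul hcoeff
    simp only at hi hj
    obtain ⟨j', rfl⟩ : 7 ∣ j := by
      by_contra h7
      exact hj (coeff_expand_of_not_dvd 7 _ _ h7)
    rw [coeff_expand_mul] at hj
    obtain ⟨k, rfl⟩ := not_not.1 ((coeff_pentagonalSeries_eq_zero_iff (ZMod 3)).not.1 hi)
    obtain ⟨l, rfl⟩ := not_not.1 ((coeff_pentagonalSeries_eq_zero_iff (ZMod 3)).not.1 hj)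
    obtain ⟨x, hx4, hx⟩ := exists_int_of_pentagonal k
    obtain ⟨y, hy4, hy⟩ := exists_int_of_pentagonal l
    refine hne ⟨(x, y), ?_, ?_⟩
    · simp only [Finset.coe_filter, Set.mem_ofPred_eq, mem_oddReps]
      refine ⟨⟨by omega, by omega, ?_⟩, hx4⟩
      push_cast
      omega
    · simp only [Prod.mk.injEq]
      constructor <;> omega
  · rintro ⟨x, y⟩ hz
    simp only [Finset.mem_filter] at hz
    obtain ⟨hx3, hy3⟩ := emod_three_ne_zero_of_mem_oddReps hz.1
    obtain ⟨⟨-, hxy, -⟩, hx4⟩ := hz.imp_left mem_oddReps.1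
    simp only at hxy hx4 ⊢
    rw [coeff_expand_mul,
      coeff_pentagonalSeries_of_sq hx4 hx3 (sq_eq_of_emod_four hx4 hx3),
      coeff_pentagonalSeries_of_sq (hxy.symm.trans hx4) hy3
        (sq_eq_of_emod_four (hxy.symm.trans hx4) hy3), Int.cast_mul]

theorem cast_B_three_seven (n : ℕ) : (B 3 7 n : ZMod 3) = -repSum (3 * n + 1) := by
  have h30 : (3 : ZMod 3) = 0 := rfl
  rw [cast_B_three_eq_coeff (by norm_num), coeff_pentagonalSeries_mul_expand_seven,
    repSum_eq_two_mul]
  linear_combination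
    (∑ z ∈ oddReps (3 * n + 1) with z.1 % 4 = 1, ((z.1 * z.2 : ℤ) : ZMod 3)) * h30

end Comparison

/-- Corollary 1.6(i). -/
theorem B_3_7_cor (k n : ℕ) (hk : 0 < k) (hn : 0 < n) (p : ℕ) (hp : p.Prime)
    (hp2 : p % 3 = 2) :
    (B 3 7 (p ^ (2 * k) * n + (p ^ (2 * k) - 1) / 3) : ℤ)
      ≡ (-1) ^ k * (@legendreSym p ⟨hp⟩ (-7)) ^ k * (B 3 7 n : ℤ) [ZMOD 3] := by
  have : Fact p.Prime := ⟨hp⟩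
  refine (ZMod.intCast_eq_intCast_iff _ _ 3).1 ?_
  have hmod : p ^ (2 * k) % 3 = 1 := by
    rw [pow_mul, Nat.pow_mod, Nat.pow_mod p, hp2]
    simp
  have hN : 3 * (p ^ (2 * k) * n + (p ^ (2 * k) - 1) / 3) + 1 = p ^ (2 * k) * (3 * n + 1) := by
    rw [mul_add, mul_add, mul_one, ← mul_assoc, mul_comm 3, mul_assoc]
    omega
  push_cast
  rw [cast_B_three_seven, cast_B_three_seven, hN, repSum_pow_mul hp2, neg_pow]
  ring
end

section
/- Let k and n be positive integers and let p be a prime number with p ≡ 3 (mod 4). Then B_{3,5}( p^{2k} n + (p^{2k} − 1)/4 ) ≡ (−1)^k · ((−5/p)_L)^k · B_{3,5}(n) (mod 3). -/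
section QBinomial

variable {R : Type*} [CommRing R]

/-- The Gaussian binomial coefficient `[n, k]` evaluated at `q`. -/
def gaussBinom (q : R) : ℕ → ℕ → R
  | _, 0 => 1
  | 0, _ + 1 => 0
  | n + 1, k + 1 => gaussBinom q n k + q ^ (k + 1) * gaussBinom q n (k + 1)

/-- The finite `q`-Pochhammer symbol `(q; q)_n`. -/
def qFactor (q : R) (n : ℕ) : R := ∏ i ∈ Finset.range n, (1 - q ^ (i + 1))

lemma gaussBinom_eq_zero (q : R) {n k : ℕ} (h : n < k) : gaussBinom q n k = 0 := by
  induction n generalizing k with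
  | zero => obtain ⟨k, rfl⟩ := Nat.exists_eq_add_of_lt h; simp [gaussBinom]
  | succ n ih =>
    obtain ⟨k, rfl⟩ : ∃ j, k = j + 1 := ⟨k - 1, by omega⟩
    rw [gaussBinom, ih (by omega), ih (by omega)]
    simp

lemma qFactor_succ (q : R) (n : ℕ) : qFactor q (n + 1) = qFactor q n * (1 - q ^ (n + 1)) :=
  Finset.prod_range_succ _ _

lemma gaussBinom_mul_qFactor (q : R) (m k : ℕ) :
    gaussBinom q (m + k) k * (qFactor q k * qFactor q m) = qFactor q (m + k) := by
  induction h : m + k generalizing m k with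
  | zero =>
    obtain ⟨rfl, rfl⟩ : m = 0 ∧ k = 0 := by omega
    simp [gaussBinom, qFactor]
  | succ n ih =>
    rcases k with _ | k
    · obtain rfl : m = n + 1 := by omega
      simp [gaussBinom, qFactor]
    · have h1 := ih m k (by omega)
      rw [gaussBinom, qFactor_succ q n, qFactor_succ q k]
      rcases m with _ | m
      · obtain rfl : k = n := by omega
        rw [gaussBinom_eq_zero q (Nat.lt_succ_self k)]
        linear_combination (1 - q ^ (k + 1)) * h1
      · have h2 := ih m (k + 1) (by omega)
        rw [qFactor_succ q k] at h2
        rw [qFactor_succ q m] at h1 ⊢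
        have hn : q ^ (n + 1) = q ^ (k + 1) * q ^ (m + 1) := by rw [← pow_add]; congr 1; omega
        rw [hn]
        linear_combination (1 - q ^ (k + 1)) * h1 + q ^ (k + 1) * (1 - q ^ (m + 1)) * h2

/-- The `q`-binomial theorem. -/
lemma prod_add_mul_pow (q x y : R) (n : ℕ) :
    ∏ k ∈ Finset.range n, (y + x * q ^ k) =
      ∑ k ∈ Finset.range (n + 1), q ^ k.choose 2 * gaussBinom q n k * x ^ k * y ^ (n - k) := by
  induction n generalizing x with
  | zero => simp [gaussBinom]
  | succ n ih =>
    have h : ∀ k, y + x * q ^ (k + 1) = y + (x * q) * q ^ k := fun k ↦ by ring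
    rw [Finset.prod_range_succ']
    simp_rw [h]
    rw [ih, Finset.sum_range_succ' _ (n + 1)]
    have h1 : ∑ k ∈ Finset.range (n + 1), q ^ (k + 1).choose 2 * gaussBinom q (n + 1) (k + 1) *
          x ^ (k + 1) * y ^ (n + 1 - (k + 1)) =
        x * ∑ k ∈ Finset.range (n + 1), q ^ k.choose 2 * gaussBinom q n k * (x * q) ^ k *
          y ^ (n - k) +
        ∑ k ∈ Finset.range (n + 1), q ^ (k + 1).choose 2 * gaussBinom q n (k + 1) *
          (x * q) ^ (k + 1) * y ^ (n - k) := by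
      rw [Finset.mul_sum, ← Finset.sum_add_distrib]
      refine Finset.sum_congr rfl fun k _ ↦ ?_
      rw [gaussBinom, Nat.choose_succ_succ' k 1, Nat.choose_one_right, Nat.add_sub_add_right]
      ring
    have h2 : y * ∑ k ∈ Finset.range (n + 1), q ^ k.choose 2 * gaussBinom q n k * (x * q) ^ k *
          y ^ (n - k) =
        ∑ k ∈ Finset.range (n + 1), q ^ (k + 1).choose 2 * gaussBinom q n (k + 1) *
          (x * q) ^ (k + 1) * y ^ (n - k) + y ^ (n + 1) := by
      rw [Finset.sum_range_succ' _ n, Finset.sum_range_succ _ n,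
        gaussBinom_eq_zero q (Nat.lt_succ_self n), mul_add, Finset.mul_sum]
      simp only [gaussBinom, Nat.choose_zero_succ, pow_zero, Nat.sub_zero, mul_one, mul_zero,
        zero_mul, add_zero, one_mul, pow_succ']
      congr 1
      refine Finset.sum_congr rfl fun k hk ↦ ?_
      have : n - k = n - (k + 1) + 1 := by have := Finset.mem_range.1 hk; omega
      rw [this]
      ring
    rw [h1]
    simp only [gaussBinom, Nat.choose_zero_succ, pow_zero, Nat.sub_zero, mul_one, one_mul]
    linear_combination h2

end QBinomial

section TripleProduct

open PowerSeries

/-- The exponent `m j (j - 1) / 2 + s j` of a theta series. -/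
def thetaExponent (m s : ℕ) (j : ℤ) : ℕ := (m * (j * (j - 1) / 2) + s * j).toNat

lemma two_mul_ediv_two (j : ℤ) : 2 * (j * (j - 1) / 2) = j * (j - 1) := by
  have := Int.even_mul_pred_self j
  exact Int.mul_ediv_cancel' this.two_dvd

lemma natAbs_le_cast_thetaExponent {m s : ℕ} (hs : 0 < s) (hsm : s < m) (j : ℤ) :
    (j.natAbs : ℤ) ≤ m * (j * (j - 1) / 2) + s * j := by
  have h := two_mul_ediv_two j
  set T := j * (j - 1) / 2
  have hs' : (1 : ℤ) ≤ s := by exact_mod_cast hs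
  have hm' : (s : ℤ) + 1 ≤ m := by exact_mod_cast hsm
  rcases le_or_gt 0 j with hj | hj
  · have : 0 ≤ T := by
      rcases hj.eq_or_lt with rfl | hj
      · linarith
      · nlinarith
    rw [Int.natAbs_of_nonneg hj]
    nlinarith
  · have : -j ≤ T := by nlinarith
    rw [Int.ofNat_natAbs_of_nonpos hj.le]
    nlinarith

lemma cast_thetaExponent {m s : ℕ} (hs : 0 < s) (hsm : s < m) (j : ℤ) :
    (thetaExponent m s j : ℤ) = m * (j * (j - 1) / 2) + s * j :=
  Int.toNat_of_nonneg (le_trans (by positivity) (natAbs_le_cast_thetaExponent hs hsm j))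

lemma natAbs_le_thetaExponent {m s : ℕ} (hs : 0 < s) (hsm : s < m) (j : ℤ) :
    j.natAbs ≤ thetaExponent m s j := by
  have := natAbs_le_cast_thetaExponent hs hsm j
  rw [← cast_thetaExponent hs hsm] at this
  exact_mod_cast this

variable (R : Type*) [CommRing R]

/-- The partial products of `(X ^ s; X ^ m) (X ^ (m - s); X ^ m)`. -/
noncomputable def thetaProd (m s N : ℕ) : R⟦X⟧ :=
  ∏ k ∈ Finset.range N, ((1 - X ^ (m * k + s)) * (1 - X ^ (m * k + (m - s))))

variable {R}

lemma prod_sub_eq_thetaProd {m s : ℕ} (hsm : s < m) (N : ℕ) :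
    ∏ k ∈ Finset.range (2 * N), (((X : R⟦X⟧) ^ m) ^ N + -X ^ s * (X ^ m) ^ k) =
      (-1) ^ N * X ^ (s * N + m * N.choose 2 + m * N * N) * thetaProd R m s N := by
  have h1 : ∏ k ∈ Finset.range N, (((X : R⟦X⟧) ^ m) ^ N + -X ^ s * (X ^ m) ^ (N + k)) =
      X ^ (m * N * N) * ∏ k ∈ Finset.range N, (1 - X ^ (m * k + s)) := by
    have h3 : (X : R⟦X⟧) ^ (m * N * N) = ∏ _k ∈ Finset.range N, X ^ (m * N) := by
      rw [Finset.prod_const, Finset.card_range, pow_mul _ (m * N)]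
    rw [h3, ← Finset.prod_mul_distrib]
    exact Finset.prod_congr rfl fun k _ ↦ by ring
  have h2 : ∏ k ∈ Finset.range N, (((X : R⟦X⟧) ^ m) ^ N + -X ^ s * (X ^ m) ^ k) =
      (-1) ^ N * X ^ (s * N + m * N.choose 2) *
        ∏ k ∈ Finset.range N, (1 - X ^ (m * k + (m - s))) := by
    have h3 : (X : R⟦X⟧) ^ (m * N.choose 2) = ∏ k ∈ Finset.range N, X ^ (m * k) := by
      rw [Finset.prod_pow_eq_pow_sum, ← Finset.mul_sum, Finset.sum_range_id, Nat.choose_two_right]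
    rw [← Finset.prod_range_reflect (fun k ↦ 1 - (X : R⟦X⟧) ^ (m * k + (m - s))), pow_add, h3,
      pow_mul, ← mul_assoc, ← mul_pow]
    nth_rewrite 3 [← Finset.card_range N]
    rw [← Finset.prod_const, ← Finset.prod_mul_distrib, ← Finset.prod_mul_distrib]
    refine Finset.prod_congr rfl fun k hk ↦ ?_
    have hk := Finset.mem_range.1 hk
    obtain ⟨r, rfl⟩ := Nat.exists_eq_add_of_lt hk
    obtain ⟨t, rfl⟩ := Nat.exists_eq_add_of_lt hsm
    rw [show k + r + 1 - 1 - k = r by omega, show s + t + 1 - s = t + 1 by omega]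
    ring
  rw [two_mul, Finset.prod_range_add, h1, h2, thetaProd, Finset.prod_mul_distrib]
  ring

lemma thetaProd_eq_sum {m s : ℕ} (hs : 0 < s) (hsm : s < m) (N : ℕ) :
    thetaProd R m s N = ∑ j ∈ Finset.Icc (-N : ℤ) N,
      gaussBinom (X ^ m) (2 * N) (j + N).toNat * ((j.negOnePow : ℤ) : R⟦X⟧) *
        X ^ thetaExponent m s j := by
  have h := prod_sub_eq_thetaProd (R := R) hsm N
  rw [prod_add_mul_pow] at h
  have h2 : ∑ k ∈ Finset.range (2 * N + 1), ((X : R⟦X⟧) ^ m) ^ k.choose 2 *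
        gaussBinom (X ^ m) (2 * N) k * (-X ^ s) ^ k * ((X ^ m) ^ N) ^ (2 * N - k) =
      (-1) ^ N * X ^ (s * N + m * N.choose 2 + m * N * N) * ∑ j ∈ Finset.Icc (-N : ℤ) N,
        gaussBinom (X ^ m) (2 * N) (j + N).toNat * ((j.negOnePow : ℤ) : R⟦X⟧) *
        X ^ thetaExponent m s j := by
    rw [Finset.mul_sum]
    refine Finset.sum_bij' (fun k _ ↦ (k : ℤ) - N) (fun j _ ↦ (j + N).toNat) ?_ ?_ ?_ ?_ ?_
    · intro k hk
      simp only [Finset.mem_range, Finset.mem_Icc] at hk ⊢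
      omega
    · intro k hk
      simp only [Finset.mem_range, Finset.mem_Icc] at hk ⊢
      omega
    · intro k hk
      simp
    · intro k hk
      simp only [Finset.mem_Icc] at hk
      omega
    · intro k hk
      have hk' := Finset.mem_range.1 hk
      have e1 : ((k : ℤ) - N + N).toNat = k := by omega
      have e2 : ((((k : ℤ) - N).negOnePow : ℤ) : R⟦X⟧) = (-1) ^ k * (-1) ^ N := by
        rw [Int.negOnePow_sub]
        push_cast
        rw [Int.cast_negOnePow_natCast, Int.cast_negOnePow_natCast]
      have e3 : m * k.choose 2 + s * k + m * N * (2 * N - k) =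
          s * N + m * N.choose 2 + m * N * N + thetaExponent m s (k - N) := by
        zify [show k ≤ 2 * N by omega]
        rw [cast_thetaExponent hs hsm]
        have c : ∀ a : ℕ, ((a.choose 2 : ℕ) : ℤ) = a * (a - 1) / 2 := fun a ↦ by
          rw [Nat.choose_two_right]
          rcases a with _ | a
          · simp
          · push_cast; simp
        have t1 := two_mul_ediv_two k
        have t2 := two_mul_ediv_two N
        have t3 := two_mul_ediv_two (k - N)
        rw [← c] at t1 t2
        have : (2 : ℤ) ≠ 0 := two_ne_zero
        apply mul_left_cancel₀ this
        linear_combination m * (t1 - t2 - t3)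
      have e4 : ((-1 : R⟦X⟧)) ^ N * (-1) ^ N = 1 := by rw [← mul_pow]; simp
      rw [e1, e2, neg_pow, ← pow_mul, ← pow_mul, ← pow_mul, ← pow_mul]
      have e5 := congrArg (fun t ↦ (X : R⟦X⟧) ^ t) e3
      simp only [pow_add] at e5 ⊢
      linear_combination gaussBinom (X ^ m) (2 * N) k * (-1 : R⟦X⟧) ^ k * e5 -
        gaussBinom (X ^ m) (2 * N) k * (-1 : R⟦X⟧) ^ k * X ^ (s * N) * X ^ (m * N.choose 2) *
        X ^ (m * N * N) * X ^ thetaExponent m s (k - N) * e4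
  rw [h2, mul_assoc (_ ^ N), mul_assoc (_ ^ N)] at h
  have hu : IsUnit ((-1 : R⟦X⟧) ^ N) := isUnit_one.neg.pow N
  exact (X_pow_mul_cancel (hu.mul_left_cancel h)).symm

lemma isUnit_qFactor_X_pow {m : ℕ} (hm : 0 < m) (n : ℕ) : IsUnit (qFactor ((X : R⟦X⟧) ^ m) n) := by
  rw [PowerSeries.isUnit_iff_constantCoeff, qFactor, map_prod]
  simp [hm.ne']

lemma pow_dvd_qFactor_sub {A : Type*} [CommRing A] (q : A) {r n : ℕ} (h : r ≤ n) :
    q ^ (r + 1) ∣ qFactor q n - qFactor q r := by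
  induction n, h using Nat.le_induction with
  | base => simp
  | succ n h ih =>
    rw [qFactor_succ]
    have : qFactor q n * (1 - q ^ (n + 1)) - qFactor q r =
      (qFactor q n - qFactor q r) - q ^ (n + 1) * qFactor q n := by ring
    rw [this]
    exact dvd_sub ih (Dvd.dvd.mul_right (pow_dvd_pow _ (by omega)) _)

lemma pow_dvd_qFactor_mul_gaussBinom_sub_one {m : ℕ} (hm : 0 < m) (a b r N : ℕ) (ha : r ≤ a)
    (hb : r ≤ b) (hN : r ≤ N) :
    ((X : R⟦X⟧) ^ m) ^ (r + 1) ∣ qFactor (X ^ m) N * gaussBinom (X ^ m) (a + b) b - 1 := by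
  set q : R⟦X⟧ := X ^ m
  have h := gaussBinom_mul_qFactor q a b
  have d := fun {n : ℕ} (hn : r ≤ n) ↦ pow_dvd_qFactor_sub q hn
  obtain ⟨c1, h1⟩ := d ha
  obtain ⟨c2, h2⟩ := d hb
  obtain ⟨c3, h3⟩ := d hN
  obtain ⟨c4, h4⟩ := d (le_add_right ha : r ≤ a + b)
  have hu : IsUnit (qFactor q r) := isUnit_qFactor_X_pow hm r
  rw [← hu.dvd_mul_left]
  rw [sub_eq_iff_eq_add] at h1 h2 h3 h4
  rw [h1, h2, h4] at h
  rw [h3]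
  set g := gaussBinom q (a + b) b
  set u := qFactor q r
  refine ⟨c4 + u * c3 * g - g * (c2 * u + c1 * u + q ^ (r + 1) * c1 * c2), ?_⟩
  linear_combination h

/-- A truncated form of the Jacobi triple product identity. -/
lemma X_pow_dvd_thetaProd_mul_qFactor_sub {m s : ℕ} (hs : 0 < s) (hsm : s < m) (N : ℕ) :
    (X : R⟦X⟧) ^ (N + 1) ∣ thetaProd R m s N * qFactor (X ^ m) N -
      ∑ j ∈ Finset.Icc (-N : ℤ) N, ((j.negOnePow : ℤ) : R⟦X⟧) * X ^ thetaExponent m s j := by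
  rw [thetaProd_eq_sum hs hsm, Finset.sum_mul, ← Finset.sum_sub_distrib]
  refine Finset.dvd_sum fun j hj ↦ ?_
  rw [Finset.mem_Icc] at hj
  have h := pow_dvd_qFactor_mul_gaussBinom_sub_one (R := R) (hs.trans hsm) (N - j).toNat
    (j + N).toNat (N - j.natAbs) N (by omega) (by omega) (by omega)
  rw [show (N - j).toNat + (j + N).toNat = 2 * N by omega] at h
  have he := natAbs_le_thetaExponent hs hsm j
  have hm : N - j.natAbs + 1 ≤ m * (N - j.natAbs + 1) := Nat.le_mul_of_pos_left _ (by omega)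
  have h' : (X : R⟦X⟧) ^ (N + 1) ∣ ((X : R⟦X⟧) ^ m) ^ (N - j.natAbs + 1) *
      X ^ thetaExponent m s j := by
    rw [← pow_mul, ← pow_add]
    exact pow_dvd_pow _ (by omega)
  refine h'.trans ?_
  have : gaussBinom (X ^ m) (2 * N) (j + N).toNat * ((j.negOnePow : ℤ) : R⟦X⟧) *
      X ^ thetaExponent m s j * qFactor (X ^ m) N -
      ((j.negOnePow : ℤ) : R⟦X⟧) * X ^ thetaExponent m s j =
      ((qFactor (X ^ m) N * gaussBinom (X ^ m) (2 * N) (j + N).toNat - 1) *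
        X ^ thetaExponent m s j) * ((j.negOnePow : ℤ) : R⟦X⟧) := by ring
  rw [this]
  exact Dvd.dvd.mul_right (mul_dvd_mul_right h _) _

end TripleProduct

lemma regularPartitionCount_eq_card_restricted (t n : ℕ) :
    regularPartitionCount t n = (Nat.Partition.restricted n (¬ t ∣ ·)).card := by
  rw [regularPartitionCount, Nat.card_eq_fintype_card, Fintype.card_subtype]
  rfl

section GeneratingFunction

open PowerSeries PowerSeries.WithPiTopology Filter

variable (R : Type*) [CommRing R]

/-- The generating function of the `t`-regular partitions. -/
noncomputable def regularGenFun (t : ℕ) : R⟦X⟧ :=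
  PowerSeries.mk fun n ↦ (regularPartitionCount t n : R)

lemma cast_B (u v n : ℕ) :
    (B u v n : R) = coeff n (regularGenFun R u * regularGenFun R v) := by
  rw [coeff_mul, Finset.Nat.sum_antidiagonal_eq_sum_range_succ_mk, B]
  simp [regularGenFun]

variable {R}

lemma eventually_X_pow_dvd_prod_sub [TopologicalSpace R] [DiscreteTopology R] {f : ℕ → R⟦X⟧}
    {g : R⟦X⟧} (h : HasProd f g) (M : ℕ) :
    ∀ᶠ n in atTop, X ^ M ∣ ∏ i ∈ Finset.range n, f i - g := by
  have h1 := (tendsto_iff_coeff_tendsto _ _ _ _).1 h.tendsto_prod_nat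
  have h2 : ∀ d ∈ Finset.range M, ∀ᶠ n in atTop,
      coeff d (∏ i ∈ Finset.range n, f i) = coeff d g := fun d _ ↦ by
    have := h1 d
    rwa [nhds_discrete, tendsto_pure] at this
  filter_upwards [(Finset.eventually_all _).2 h2] with n hn
  rw [X_pow_dvd_iff]
  intro d hd
  rw [map_sub, hn d (Finset.mem_range.2 hd), sub_self]

lemma eventually_X_pow_dvd_regularGenFun_three (M : ℕ) :
    ∀ᶠ n in atTop, (X : (ZMod 3)⟦X⟧) ^ M ∣
      (∏ i ∈ Finset.range n, (1 - X ^ (i + 1))) ^ 2 - regularGenFun (ZMod 3) 3 := by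
  let _ : TopologicalSpace (ZMod 3) := ⊥
  have _ : DiscreteTopology (ZMod 3) := ⟨rfl⟩
  have h := Nat.Partition.hasProd_powerSeriesMk_card_countRestricted (ZMod 3) (m := 3) (by norm_num)
  rw [← Nat.Partition.powerSeriesMk_card_restricted_eq_powerSeriesMk_card_countRestricted (ZMod 3)
    (by norm_num)] at h
  have h3 : (3 : (ZMod 3)⟦X⟧) = 0 := by
    have : C ((3 : ℕ) : ZMod 3) = 3 := map_natCast (C (R := ZMod 3)) 3
    rw [← this, ZMod.natCast_self, map_zero]
  filter_upwards [eventually_X_pow_dvd_prod_sub h M] with n hn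
  convert! hn using 1
  congr 1
  · rw [← Finset.prod_pow]
    refine Finset.prod_congr rfl fun i _ ↦ ?_
    simp only [Finset.sum_range_succ, Finset.range_zero, Finset.sum_empty]
    linear_combination - X ^ (i + 1) * h3
  · simp_rw [regularGenFun, regularPartitionCount_eq_card_restricted]

lemma eventually_X_pow_dvd_regularGenFun_mul_prod (R : Type*) [CommRing R] (t M : ℕ) :
    ∀ᶠ n in atTop, (X : R⟦X⟧) ^ M ∣
      1 - regularGenFun R t * ∏ i ∈ Finset.range n, if t ∣ i + 1 then 1 else 1 - X ^ (i + 1) := by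
  let _ : TopologicalSpace R := ⊥
  have _ : DiscreteTopology R := ⟨rfl⟩
  have h := Nat.Partition.hasProd_powerSeriesMk_card_restricted R (¬ t ∣ ·)
  filter_upwards [eventually_X_pow_dvd_prod_sub h M] with n hn
  have hg : (PowerSeries.mk fun n ↦ ((Nat.Partition.restricted n (¬ t ∣ ·)).card : R)) =
      regularGenFun R t := by
    simp_rw [regularGenFun, regularPartitionCount_eq_card_restricted]
  rw [hg] at hn
  convert hn.mul_right (∏ i ∈ Finset.range n, if t ∣ i + 1 then 1 else 1 - X ^ (i + 1)) using 1
  rw [sub_mul, ← Finset.prod_mul_distrib]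
  congr 1
  refine (Finset.prod_eq_one fun i _ ↦ ?_).symm
  split_ifs with h
  · simp_all
  · simp_rw [pow_mul]
    exact tsum_pow_mul_one_sub_of_constantCoeff_eq_zero (by simp)

lemma prod_range_five_mul_ite (N : ℕ) :
    (∏ i ∈ Finset.range (5 * N), if 5 ∣ i + 1 then (1 : R⟦X⟧) else 1 - X ^ (i + 1)) =
      thetaProd R 5 1 N * thetaProd R 5 2 N := by
  induction N with
  | zero => simp [thetaProd]
  | succ N ih =>
    rw [thetaProd, thetaProd, Finset.prod_range_succ _ N, Finset.prod_range_succ _ N, ← thetaProd,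
      ← thetaProd, Nat.mul_succ]
    simp only [Finset.prod_range_succ _ (5 * N + _), Finset.prod_range_succ _ (5 * N), ih]
    rw [if_neg (by omega), if_neg (by omega), if_neg (by omega), if_neg (by omega),
      if_pos (by omega)]
    ring

lemma prod_range_five_mul (N : ℕ) :
    (∏ i ∈ Finset.range (5 * N), (1 - (X : R⟦X⟧) ^ (i + 1))) =
      thetaProd R 5 1 N * thetaProd R 5 2 N * qFactor (X ^ 5) N := by
  induction N with
  | zero => simp [thetaProd, qFactor]
  | succ N ih =>
    rw [thetaProd, thetaProd, Finset.prod_range_succ _ N, Finset.prod_range_succ _ N, ← thetaProd,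
      ← thetaProd, Nat.mul_succ, qFactor_succ]
    simp only [Finset.prod_range_succ _ (5 * N + _), Finset.prod_range_succ _ (5 * N), ih]
    ring

/-- The coefficients of the product of the two theta series of modulus five, as a sum over the
pairs `(i, j)` with `40 n + 10 = (10 i - 3) ^ 2 + (10 j - 1) ^ 2`. -/
noncomputable def thetaCoeff (n : ℕ) : ℤ :=
  ∑ x ∈ Finset.Icc (-n : ℤ) n ×ˢ Finset.Icc (-n : ℤ) n with
    (10 * x.1 - 3) ^ 2 + (10 * x.2 - 1) ^ 2 = 40 * (n : ℤ) + 10, ((x.1 + x.2).negOnePow : ℤ)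

lemma thetaExponent_five_eq_iff (i j : ℤ) (n : ℕ) :
    thetaExponent 5 1 i + thetaExponent 5 2 j = n ↔
      (10 * i - 3) ^ 2 + (10 * j - 1) ^ 2 = 40 * (n : ℤ) + 10 := by
  have h1 := cast_thetaExponent (m := 5) (s := 1) (by norm_num) (by norm_num) i
  have h2 := cast_thetaExponent (m := 5) (s := 2) (by norm_num) (by norm_num) j
  have t1 := two_mul_ediv_two i
  have t2 := two_mul_ediv_two j
  rw [← Nat.cast_inj (R := ℤ), Nat.cast_add, h1, h2]
  push_cast
  constructor <;> intro h
  · linear_combination 40 * h - 100 * t1 - 100 * t2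
  · apply mul_left_cancel₀ (two_ne_zero : (2 : ℤ) ≠ 0)
    have : (40 : ℤ) ≠ 0 := by norm_num
    apply mul_left_cancel₀ this
    linear_combination 2 * h + 200 * t1 + 200 * t2

lemma mem_Icc_of_sq_add_sq_eq {i j : ℤ} {n : ℕ}
    (h : (10 * i - 3) ^ 2 + (10 * j - 1) ^ 2 = 40 * (n : ℤ) + 10) :
    i ∈ Finset.Icc (-n : ℤ) n ∧ j ∈ Finset.Icc (-n : ℤ) n := by
  rw [← thetaExponent_five_eq_iff] at h
  have h1 := natAbs_le_thetaExponent (m := 5) (s := 1) (by norm_num) (by norm_num) i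
  have h2 := natAbs_le_thetaExponent (m := 5) (s := 2) (by norm_num) (by norm_num) j
  simp only [Finset.mem_Icc]
  omega

lemma mem_filter_sq_add_sq {x : ℤ × ℤ} {n N : ℕ} (h : n ≤ N) :
    x ∈ (Finset.Icc (-N : ℤ) N ×ˢ Finset.Icc (-N : ℤ) N).filter (fun x ↦
      (10 * x.1 - 3) ^ 2 + (10 * x.2 - 1) ^ 2 = 40 * (n : ℤ) + 10) ↔
    (10 * x.1 - 3) ^ 2 + (10 * x.2 - 1) ^ 2 = 40 * (n : ℤ) + 10 := by
  simp only [Finset.mem_filter, Finset.mem_product, and_iff_right_iff_imp]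
  intro hx
  have := mem_Icc_of_sq_add_sq_eq hx
  simp only [Finset.mem_Icc] at this ⊢
  omega

lemma cast_thetaCoeff {n N : ℕ} (h : n ≤ N) :
    (thetaCoeff n : R) = coeff n
      ((∑ j ∈ Finset.Icc (-N : ℤ) N, ((j.negOnePow : ℤ) : R⟦X⟧) * X ^ thetaExponent 5 1 j) *
       (∑ j ∈ Finset.Icc (-N : ℤ) N, ((j.negOnePow : ℤ) : R⟦X⟧) * X ^ thetaExponent 5 2 j)) := by
  have hN : thetaCoeff n = ∑ x ∈ Finset.Icc (-N : ℤ) N ×ˢ Finset.Icc (-N : ℤ) N with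
      (10 * x.1 - 3) ^ 2 + (10 * x.2 - 1) ^ 2 = 40 * (n : ℤ) + 10,
        ((x.1 + x.2).negOnePow : ℤ) := by
    refine Finset.sum_congr ?_ fun _ _ ↦ rfl
    ext x
    rw [mem_filter_sq_add_sq le_rfl, mem_filter_sq_add_sq h]
  rw [hN, Finset.sum_mul_sum, ← Finset.sum_product', map_sum, Finset.sum_filter]
  push_cast
  refine Finset.sum_congr rfl fun x _ ↦ ?_
  have : ((x.1.negOnePow : ℤ) : R⟦X⟧) * X ^ thetaExponent 5 1 x.1 *
      (((x.2.negOnePow : ℤ) : R⟦X⟧) * X ^ thetaExponent 5 2 x.2) =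
      C (((x.1 + x.2).negOnePow : ℤ) : R) * X ^ (thetaExponent 5 1 x.1 + thetaExponent 5 2 x.2) := by
    rw [Int.negOnePow_add, map_intCast, pow_add]
    push_cast
    ring
  rw [this, coeff_C_mul, coeff_X_pow]
  simp_rw [← thetaExponent_five_eq_iff, eq_comm (a := n), mul_ite, mul_one, mul_zero]

lemma cast_B_three_five (n : ℕ) : (B 3 5 n : ZMod 3) = (thetaCoeff n : ZMod 3) := by
  have h5 : Tendsto (fun N : ℕ ↦ 5 * N) atTop atTop :=
    tendsto_id.const_mul_atTop' (by norm_num)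
  obtain ⟨N, h1, h2, hN⟩ := ((h5.eventually (eventually_X_pow_dvd_regularGenFun_three (n + 1))).and
    ((h5.eventually (eventually_X_pow_dvd_regularGenFun_mul_prod (ZMod 3) 5 (n + 1))).and
      (eventually_ge_atTop n))).exists
  have hd : (X : (ZMod 3)⟦X⟧) ^ (n + 1) ∣ X ^ (N + 1) := pow_dvd_pow _ (by omega)
  have h3 := hd.trans (X_pow_dvd_thetaProd_mul_qFactor_sub (R := ZMod 3) (m := 5) (s := 1)
    (by norm_num) (by norm_num) N)
  have h4 := hd.trans (X_pow_dvd_thetaProd_mul_qFactor_sub (R := ZMod 3) (m := 5) (s := 2)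
    (by norm_num) (by norm_num) N)
  rw [cast_B, cast_thetaCoeff hN, ← sub_eq_zero, ← map_sub]
  rw [prod_range_five_mul] at h1
  rw [prod_range_five_mul_ite] at h2
  refine (X_pow_dvd_iff (n := n + 1)).1 ?_ n (Nat.lt_succ_self n)
  obtain ⟨a, ha⟩ := h1
  obtain ⟨b, hb⟩ := h2
  obtain ⟨c, hc⟩ := h3
  obtain ⟨d, hd⟩ := h4
  generalize regularGenFun (ZMod 3) 3 = G at *
  generalize regularGenFun (ZMod 3) 5 = H at *
  generalize ∑ j ∈ Finset.Icc (-N : ℤ) N, ((j.negOnePow : ℤ) : (ZMod 3)⟦X⟧) *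
    X ^ thetaExponent 5 1 j = S at *
  generalize ∑ j ∈ Finset.Icc (-N : ℤ) N, ((j.negOnePow : ℤ) : (ZMod 3)⟦X⟧) *
    X ^ thetaExponent 5 2 j = T at *
  generalize thetaProd (ZMod 3) 5 1 N = P at *
  generalize thetaProd (ZMod 3) 5 2 N = Q at *
  generalize qFactor ((X : (ZMod 3)⟦X⟧) ^ 5) N = F at *
  refine ⟨-a * H - b * (P * Q * F ^ 2) + c * (Q * F) + S * d, ?_⟩
  linear_combination -H * ha - P * Q * F ^ 2 * hb + Q * F * hc + S * hd

end GeneratingFunction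

lemma dvd_of_dvd_sq_add_sq {p : ℕ} (hp : p.Prime) (hp3 : p % 4 = 3) {u v : ℤ}
    (h : (p : ℤ) ∣ u ^ 2 + v ^ 2) : (p : ℤ) ∣ u ∧ (p : ℤ) ∣ v := by
  have _ : Fact p.Prime := ⟨hp⟩
  simp only [← ZMod.intCast_zmod_eq_zero_iff_dvd, Int.cast_add, Int.cast_pow] at h ⊢
  by_contra hne
  have h1 : (u : ZMod p) ^ 2 = -(v : ZMod p) ^ 2 := by linear_combination h
  by_cases hu : (u : ZMod p) = 0
  · rw [hu] at h1
    exact hne ⟨hu, by simpa using h1.symm⟩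
  · exact ZMod.mod_four_ne_three_of_sq_eq_neg_sq hu h1 hp3

lemma sq_mul_add_div {p : ℕ} (hp3 : p % 2 = 1) (n : ℕ) :
    (40 : ℤ) * (p ^ 2 * n + (p ^ 2 - 1) / 4 : ℕ) + 10 = p ^ 2 * (40 * n + 10) := by
  obtain ⟨m, rfl⟩ : ∃ m, p = 2 * m + 1 := ⟨p / 2, by omega⟩
  have : ((2 * m + 1) ^ 2 - 1) / 4 = m ^ 2 + m := by
    rw [show (2 * m + 1) ^ 2 - 1 = 4 * (m ^ 2 + m) by
      rw [show (2 * m + 1) ^ 2 = 4 * (m ^ 2 + m) + 1 by ring]; simp]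
    simp
  rw [this]
  push_cast
  ring

/-- A sign-twisted bijection between representations which scales norms by `p ^ 2` relates
`thetaCoeff` at the two indices. -/
lemma thetaCoeff_eq_mul_of_map {p : ℕ} (hp : p.Prime) (hp3 : p % 4 = 3) (s : ℤ)
    (f : ℤ × ℤ → ℤ × ℤ)
    (hnorm : ∀ i j, (10 * (f (i, j)).1 - 3) ^ 2 + (10 * (f (i, j)).2 - 1) ^ 2 =
      (p : ℤ) ^ 2 * ((10 * i - 3) ^ 2 + (10 * j - 1) ^ 2))
    (hinj : Function.Injective f)
    (hsign : ∀ i j, (((f (i, j)).1 + (f (i, j)).2).negOnePow : ℤ) = s * ((i + j).negOnePow : ℤ))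
    (hsurj : ∀ i j a b : ℤ, 10 * i - 3 = p * a → 10 * j - 1 = p * b → (i, j) ∈ Set.range f)
    (n : ℕ) : thetaCoeff (p ^ 2 * n + (p ^ 2 - 1) / 4) = s * thetaCoeff n := by
  have hp0 : (p : ℤ) ^ 2 ≠ 0 := pow_ne_zero _ (by exact_mod_cast hp.ne_zero)
  have hidx := sq_mul_add_div (p := p) (by omega) n
  rw [thetaCoeff, thetaCoeff, Finset.mul_sum]
  symm
  refine Finset.sum_bij (fun x _ ↦ f x) ?_ (fun _ _ _ _ h ↦ hinj h) ?_ ?_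
  · rintro ⟨i, j⟩ hx
    rw [mem_filter_sq_add_sq le_rfl] at hx ⊢
    rw [hnorm, hidx, hx]
  · rintro ⟨i, j⟩ hx
    rw [mem_filter_sq_add_sq le_rfl, hidx] at hx
    have hd : (p : ℤ) ∣ (10 * i - 3) ^ 2 + (10 * j - 1) ^ 2 :=
      ⟨p * (40 * n + 10), by rw [hx]; ring⟩
    obtain ⟨⟨a, ha⟩, b, hb⟩ := dvd_of_dvd_sq_add_sq hp hp3 hd
    obtain ⟨⟨i', j'⟩, hf⟩ := hsurj i j a b ha hb
    refine ⟨(i', j'), ?_, hf⟩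
    rw [mem_filter_sq_add_sq le_rfl]
    have := hnorm i' j'
    rw [hf, hx] at this
    exact (mul_left_cancel₀ hp0 this).symm
  · rintro ⟨i, j⟩ hx
    exact (hsign i j).symm

lemma legendreSym_neg_five {p : ℕ} [Fact p.Prime] (hp3 : p % 4 = 3) :
    legendreSym p (-5) = if p % 5 = 1 ∨ p % 5 = 4 then -1 else 1 := by
  have _ : Fact (Nat.Prime 5) := ⟨by norm_num⟩
  have hp2 : p ≠ 2 := by omega
  have h5 : p % 5 ≠ 0 := fun h ↦ by
    have := (Nat.prime_dvd_prime_iff_eq (by norm_num) (Fact.out : p.Prime)).1 (Nat.dvd_of_mod_eq_zero h)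
    omega
  have h1 : legendreSym p 5 = legendreSym 5 p := by
    exact_mod_cast legendreSym.quadratic_reciprocity_one_mod_four (p := 5) (q := p) (by norm_num) hp2
  rw [show (-5 : ℤ) = -1 * 5 by norm_num, legendreSym.mul, legendreSym.at_neg_one hp2,
    ZMod.χ₄_nat_three_mod_four hp3, h1, legendreSym.mod]
  have h : p % 5 = 1 ∨ p % 5 = 2 ∨ p % 5 = 3 ∨ p % 5 = 4 := by omega
  have hc : ((p : ℤ) % (5 : ℕ)) = ((p % 5 : ℕ) : ℤ) := by norm_cast
  rw [hc]
  rcases h with h | h | h | h <;> norm_num [h]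

lemma thetaCoeff_sq_mul_add {p : ℕ} [Fact p.Prime] (hp3 : p % 4 = 3) (n : ℕ) :
    thetaCoeff (p ^ 2 * n + (p ^ 2 - 1) / 4) = -legendreSym p (-5) * thetaCoeff n := by
  have hp : p.Prime := Fact.out
  have h5 : p % 5 ≠ 0 := fun h ↦ by
    have := (Nat.prime_dvd_prime_iff_eq (by norm_num) hp).1 (Nat.dvd_of_mod_eq_zero h)
    omega
  rw [legendreSym_neg_five hp3]
  have hpos : (p : ℤ) ≠ 0 := by exact_mod_cast hp.ne_zero
  have sgn : ∀ a b : ℤ, Even (a - b) → (a.negOnePow : ℤ) = 1 * (b.negOnePow : ℤ) := fun a b h ↦ by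
    rw [one_mul, (Int.negOnePow_eq_iff a b).2 h]
  have sgn' : ∀ a b : ℤ, Even (a - (b + 1)) → (a.negOnePow : ℤ) = -1 * (b.negOnePow : ℤ) :=
    fun a b h ↦ by
      rw [(Int.negOnePow_eq_iff a (b + 1)).2 h, Int.negOnePow_succ]
      simp
  have hr : p % 20 = 3 ∨ p % 20 = 7 ∨ p % 20 = 11 ∨ p % 20 = 19 := by omega
  obtain ⟨m, hm⟩ : ∃ m, m = p / 20 := ⟨_, rfl⟩
  rcases hr with h | h | h | h
  · obtain rfl : p = 20 * m + 3 := by omega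
    rw [if_neg (by omega)]
    push_cast at hpos
    refine thetaCoeff_eq_mul_of_map hp hp3 _
      (fun x ↦ (20 * m * x.2 - 2 * m + 3 * x.2, -20 * m * x.1 + 6 * m - 3 * x.1 + 1))
      ?_ ?_ ?_ ?_ n
    · intro i j
      push_cast
      ring
    · rintro ⟨i, j⟩ ⟨i', j'⟩ hx
      simp only [Prod.mk.injEq] at hx ⊢
      constructor <;> apply mul_left_cancel₀ hpos
      · linear_combination -hx.2
      · linear_combination hx.1
    · intro i j
      exact sgn' _ _ ⟨10 * m * j + 2 * m + j - 10 * m * i - 2 * i, by ring⟩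
    · intro i j a b ha hb
      push_cast at ha hb
      have ha' : 10 * i - 3 = 20 * (m * a) + 3 * a := by linear_combination ha
      have hb' : 10 * j - 1 = 20 * (m * b) + 3 * b := by linear_combination hb
      obtain ⟨x, hx⟩ : ∃ x, b = -(10 * x - 3) := ⟨(3 - b) / 10, by omega⟩
      obtain ⟨y, hy⟩ : ∃ y, a = 10 * y - 1 := ⟨(a + 1) / 10, by omega⟩
      subst hx hy
      refine ⟨(x, y), Prod.ext ?_ ?_⟩ <;> dsimp only <;> linarith
  · obtain rfl : p = 20 * m + 7 := by omega
    rw [if_neg (by omega)]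
    push_cast at hpos
    refine thetaCoeff_eq_mul_of_map hp hp3 _
      (fun x ↦ (-20 * m * x.2 + 2 * m - 7 * x.2 + 1, 20 * m * x.1 - 6 * m + 7 * x.1 - 2))
      ?_ ?_ ?_ ?_ n
    · intro i j
      push_cast
      ring
    · rintro ⟨i, j⟩ ⟨i', j'⟩ hx
      simp only [Prod.mk.injEq] at hx ⊢
      constructor <;> apply mul_left_cancel₀ hpos
      · linear_combination hx.2
      · linear_combination -hx.1
    · intro i j
      exact sgn' _ _ ⟨-10 * m * j - 2 * m - 4 * j + 10 * m * i + 3 * i - 1, by ring⟩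
    · intro i j a b ha hb
      push_cast at ha hb
      have ha' : 10 * i - 3 = 20 * (m * a) + 7 * a := by linear_combination ha
      have hb' : 10 * j - 1 = 20 * (m * b) + 7 * b := by linear_combination hb
      obtain ⟨x, hx⟩ : ∃ x, b = 10 * x - 3 := ⟨(b + 3) / 10, by omega⟩
      obtain ⟨y, hy⟩ : ∃ y, a = -(10 * y - 1) := ⟨(1 - a) / 10, by omega⟩
      subst hx hy
      refine ⟨(x, y), Prod.ext ?_ ?_⟩ <;> dsimp only <;> linarith
  · obtain rfl : p = 20 * m + 11 := by omega
    rw [if_pos (by omega)]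
    push_cast at hpos
    refine thetaCoeff_eq_mul_of_map hp hp3 _
      (fun x ↦ (20 * m * x.1 - 6 * m + 11 * x.1 - 3, 20 * m * x.2 - 2 * m + 11 * x.2 - 1))
      ?_ ?_ ?_ ?_ n
    · intro i j
      push_cast
      ring
    · rintro ⟨i, j⟩ ⟨i', j'⟩ hx
      simp only [Prod.mk.injEq] at hx ⊢
      constructor <;> apply mul_left_cancel₀ hpos
      · linear_combination hx.1
      · linear_combination hx.2
    · intro i j
      exact sgn _ _ ⟨10 * m * i + 10 * m * j - 4 * m + 5 * i + 5 * j - 2, by ring⟩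
    · intro i j a b ha hb
      push_cast at ha hb
      have ha' : 10 * i - 3 = 20 * (m * a) + 11 * a := by linear_combination ha
      have hb' : 10 * j - 1 = 20 * (m * b) + 11 * b := by linear_combination hb
      obtain ⟨x, hx⟩ : ∃ x, a = 10 * x - 3 := ⟨(a + 3) / 10, by omega⟩
      obtain ⟨y, hy⟩ : ∃ y, b = 10 * y - 1 := ⟨(b + 1) / 10, by omega⟩
      subst hx hy
      refine ⟨(x, y), Prod.ext ?_ ?_⟩ <;> dsimp only <;> linarith
  · obtain rfl : p = 20 * m + 19 := by omega
    rw [if_pos (by omega)]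
    push_cast at hpos
    refine thetaCoeff_eq_mul_of_map hp hp3 _
      (fun x ↦ (-20 * m * x.1 + 6 * m - 19 * x.1 + 6, -20 * m * x.2 + 2 * m - 19 * x.2 + 2))
      ?_ ?_ ?_ ?_ n
    · intro i j
      push_cast
      ring
    · rintro ⟨i, j⟩ ⟨i', j'⟩ hx
      simp only [Prod.mk.injEq] at hx ⊢
      constructor <;> apply mul_left_cancel₀ hpos
      · linear_combination -hx.1
      · linear_combination -hx.2
    · intro i j
      exact sgn _ _ ⟨-10 * m * i - 10 * m * j + 4 * m - 10 * i - 10 * j + 4, by ring⟩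
    · intro i j a b ha hb
      push_cast at ha hb
      have ha' : 10 * i - 3 = 20 * (m * a) + 19 * a := by linear_combination ha
      have hb' : 10 * j - 1 = 20 * (m * b) + 19 * b := by linear_combination hb
      obtain ⟨x, hx⟩ : ∃ x, a = -(10 * x - 3) := ⟨(3 - a) / 10, by omega⟩
      obtain ⟨y, hy⟩ : ∃ y, b = -(10 * y - 1) := ⟨(1 - b) / 10, by omega⟩
      subst hx hy
      refine ⟨(x, y), Prod.ext ?_ ?_⟩ <;> dsimp only <;> linarith

/-- Corollary 1.6(ii). -/
theorem B_3_5_cor (k n : ℕ) (hk : 0 < k) (hn : 0 < n) (p : ℕ) (hp : p.Prime)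
    (hp3 : p % 4 = 3) :
    (B 3 5 (p ^ (2 * k) * n + (p ^ (2 * k) - 1) / 4) : ℤ)
      ≡ (-1) ^ k * (@legendreSym p ⟨hp⟩ (-5)) ^ k * (B 3 5 n : ℤ) [ZMOD 3] := by
  have _ : Fact p.Prime := ⟨hp⟩
  have key : ∀ k : ℕ, thetaCoeff (p ^ (2 * k) * n + (p ^ (2 * k) - 1) / 4) =
      (-legendreSym p (-5)) ^ k * thetaCoeff n := by
    intro k
    induction k with
    | zero => simp
    | succ k ih =>
      rw [pow_succ', mul_assoc, ← ih, ← thetaCoeff_sq_mul_add hp3]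
      congr 1
      have hodd : p % 2 = 1 := by omega
      have hodd' : p ^ k % 2 = 1 := by rw [Nat.pow_mod, hodd]; simp
      have hodd'' : p ^ (k + 1) % 2 = 1 := by rw [Nat.pow_mod, hodd]; simp
      have e1 := sq_mul_add_div hodd' n
      have e2 := sq_mul_add_div hodd'' n
      have e3 := sq_mul_add_div hodd (p ^ (2 * k) * n + (p ^ (2 * k) - 1) / 4)
      rw [← pow_mul, mul_comm k 2] at e1
      rw [← pow_mul, mul_comm (k + 1) 2] at e2
      rw [e1] at e3
      have : (40 : ℤ) ≠ 0 := by norm_num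
      apply Nat.cast_injective (R := ℤ)
      apply mul_left_cancel₀ this
      push_cast at e1 e2 e3 ⊢
      linear_combination e2 - e3
  refine (ZMod.intCast_eq_intCast_iff _ _ 3).1 ?_
  push_cast
  rw [cast_B_three_five, cast_B_three_five, key, ← mul_pow]
  push_cast
  simp
end
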